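/- Let W = (w_{ij}) ∈ ℝ^{n×n} be a nonnegative, symmetric, doubly stochastic matrix with eigenvalues 1 = λ₁ > λ₂ ≥ ⋯ ≥ λ_n and ρ := max{|λ₂|, |λ_n|} < 1. For each i = 1, …, n, let F_i, f_i : ℝ^p × ℝ^q → ℝ be such that F_i is L_{F,0}-Lipschitz, ∇F_i is L_{F,1}-Lipschitz, f_i is twice differentiable, ∇f_i is L_{f,1}-Lipschitz, ∇²f_i is L_{f,2}-Lipschitz; set F := (1/n)Σ F_i, f := (1/n)Σ f_i, r_v := L_{F,0}/σ. Suppose f(x̄, ·) is σ-strongly convex for the given x̄ ∈ ℝ^p, and y*, v* ∈ ℝ^q satisfy ∇₂f(x̄, y*) = 0, ∇²₂₂f(x̄, y*) v* = ∇₂F(x̄, y*), and ‖v*‖ ≤ r_v. Let (x_i, y_i, v_i, t_{v,i}) be points with ‖v_i‖ ≤ r_v, averages x̄ = (1/n)Σ x_i, ȳ := (1/n)Σ y_i, v̄ := (1/n)Σ v_i, and suppose (1/n)Σ_i t_{v,i} = (1/n)Σ_{i=1}^n [∇₂F_i(x_i, y_i) − ∇²₂₂f_i(x_i, y_i) v_i]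 =: t̄_v. Let 0 < η ≤ 1/L_{f,1} with ησ ≤ 1, define v_i⁺ := 𝒫_{r_v}[Σ_{j=1}^n w_{ij}(v_j + η t_{v,j})], and v̄⁺ := (1/n)Σ_i v_i⁺. Then ‖v̄⁺ − v*‖² ≤ (1 − ησ/2)‖v̄ − v*‖² + (3η(L_{F,1} + L_{f,2} r_v)²/σ)‖ȳ − y*‖² + (9η(L_{F,1} + L_{f,2} r_v)²/(nσ)) Σ_i (‖x_i − x̄‖² + ‖y_i − ȳ‖²) + (2η²ρ²/n) Σ_i ‖t_{v,i} − t̄_v‖² + (9ηL_{f,1}²/σ + 2ρ²)·(1/n) Σ_i ‖v_i − v̄‖². -/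

import Mathlib

open Matrix

noncomputable section

/-- `Vec d` is the Euclidean space `ℝ^d`. -/
abbrev Vec (d : ℕ) : Type := EuclideanSpace ℝ (Fin d)

section InnerProduct

open scoped RealInnerProductSpace

variable {E : Type*} [NormedAddCommGroup E] [InnerProductSpace ℝ E]

/-- A nearest point of a convex set is no farther from any point of the set than the original. -/
lemma norm_sub_le_of_isNearest {K : Set E} (hK : Convex ℝ K) {z u w : E} (hu : u ∈ K)
    (hmin : ∀ w ∈ K, ‖u - z‖ ≤ ‖w - z‖) (hw : w ∈ K) : ‖u - w‖ ≤ ‖z - w‖ := by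
  have hne : Nonempty K := ⟨⟨u, hu⟩⟩
  have hinf : ‖z - u‖ = ⨅ w : K, ‖z - w‖ := by
    apply le_antisymm
    · refine le_ciInf fun w => ?_
      rw [norm_sub_rev z u, norm_sub_rev z w]
      exact hmin w w.2
    · exact ciInf_le (f := fun w : K => ‖z - w‖)
        ⟨0, by rintro _ ⟨w, rfl⟩; exact norm_nonneg _⟩ ⟨u, hu⟩
  have hinner := (norm_eq_iInf_iff_real_inner_le_zero hK hu).1 hinf w hw
  have hexp := norm_sub_sq_real (z - u) (w - u)
  rw [sub_sub_sub_cancel_right] at hexp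
  rw [norm_sub_rev u w]
  refine abs_le_of_sq_le_sq' ?_ (norm_nonneg _) |>.2
  nlinarith [sq_nonneg ‖z - u‖]

/-- A positive symmetric operator with quadratic form at most `c‖·‖²` has norm at most `c`. -/
lemma norm_apply_le_of_inner_le (T : E →L[ℝ] E) {c : ℝ} (hc : 0 ≤ c)
    (hsymm : ∀ u v, ⟪T u, v⟫ = ⟪u, T v⟫) (hpos : ∀ u, 0 ≤ ⟪T u, u⟫)
    (hle : ∀ u, ⟪T u, u⟫ ≤ c * ‖u‖ ^ 2) (u : E) : ‖T u‖ ≤ c * ‖u‖ := by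
  have key (s : ℝ) : 0 ≤ c * ‖u‖ ^ 2 - 2 * s * ‖T u‖ ^ 2 + s ^ 2 * (c * ‖T u‖ ^ 2) := by
    have h := hpos (u - s • T u)
    have hsq : ⟪T (T u), u⟫ = ‖T u‖ ^ 2 := by rw [hsymm, real_inner_self_eq_norm_sq]
    simp only [map_sub, map_smul, inner_sub_left, inner_sub_right, real_inner_smul_left,
      real_inner_smul_right, hsq, real_inner_self_eq_norm_sq] at h
    nlinarith [hle u, mul_le_mul_of_nonneg_left (hle (T u)) (sq_nonneg s)]
  refine abs_le_of_sq_le_sq' ?_ (by positivity) |>.2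
  rcases hc.eq_or_lt with rfl | hc
  · have := key 1
    nlinarith
  · have h := mul_nonneg hc.le (key c⁻¹)
    have : c * (c * ‖u‖ ^ 2 - 2 * c⁻¹ * ‖T u‖ ^ 2 + c⁻¹ ^ 2 * (c * ‖T u‖ ^ 2))
        = (c * ‖u‖) ^ 2 - ‖T u‖ ^ 2 := by
      field_simp
      ring
    linarith

/-- One inexact gradient step on a quadratic with Hessian between `σ` and `L`. -/
lemma norm_sq_inexact_step_le (H : E →L[ℝ] E) {σ L η : ℝ} (hσ : 0 < σ) (hη : 0 < η)
    (hηL : η * L ≤ 1) (hησ : η * σ ≤ 1) (hsymm : ∀ u v, ⟪H u, v⟫ = ⟪u, H v⟫)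
    (hlow : ∀ u, σ * ‖u‖ ^ 2 ≤ ⟪H u, u⟫) (hup : ‖H‖ ≤ L) (u e : E) :
    ‖u - η • H u + η • e‖ ^ 2 ≤ (1 - η * σ) * ‖u‖ ^ 2 + η / σ * ‖e‖ ^ 2 := by
  have hT : ‖u - η • H u‖ ≤ (1 - η * σ) * ‖u‖ := by
    refine norm_apply_le_of_inner_le (ContinuousLinearMap.id ℝ E - η • H) (by linarith)
      (fun u v => ?_) (fun u => ?_) (fun u => ?_) u
    · simp [inner_sub_left, inner_sub_right, real_inner_smul_left, real_inner_smul_right, hsymm]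
    · have hu : ⟪H u, u⟫ ≤ L * ‖u‖ ^ 2 := by
        calc ⟪H u, u⟫ ≤ ‖H u‖ * ‖u‖ := real_inner_le_norm _ _
          _ ≤ (L * ‖u‖) * ‖u‖ := by gcongr; exact H.le_of_opNorm_le hup u
          _ = L * ‖u‖ ^ 2 := by ring
      simp only [_root_.sub_apply, ContinuousLinearMap.id_apply,
        _root_.smul_apply, inner_sub_left, real_inner_smul_left,
        real_inner_self_eq_norm_sq]
      nlinarith [mul_le_mul_of_nonneg_left hu hη.le, sq_nonneg ‖u‖]
    · simp only [_root_.sub_apply, ContinuousLinearMap.id_apply,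
        _root_.smul_apply, inner_sub_left, real_inner_smul_left,
        real_inner_self_eq_norm_sq]
      nlinarith [mul_le_mul_of_nonneg_left (hlow u) hη.le]
  have hsum : ‖u - η • H u + η • e‖ ≤ (1 - η * σ) * ‖u‖ + η * ‖e‖ := by
    refine (norm_add_le _ _).trans ?_
    rw [norm_smul, Real.norm_of_nonneg hη.le]
    gcongr
  have hsq : ‖u - η • H u + η • e‖ ^ 2 ≤ ((1 - η * σ) * ‖u‖ + η * ‖e‖) ^ 2 := by gcongr
  have hid : (1 - η * σ) * ‖u‖ ^ 2 + η / σ * ‖e‖ ^ 2 - ((1 - η * σ) * ‖u‖ + η * ‖e‖) ^ 2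
      = η / σ * (1 - η * σ) * (σ * ‖u‖ - ‖e‖) ^ 2 := by
    field_simp
    ring
  have : 0 ≤ η / σ * (1 - η * σ) * (σ * ‖u‖ - ‖e‖) ^ 2 :=
    mul_nonneg (mul_nonneg (by positivity) (by linarith)) (sq_nonneg _)
  linarith

/-- Bias–variance decomposition around the mean. -/
lemma sum_norm_sub_sq_eq {n : ℕ} (hn : n ≠ 0) (z : Fin n → E) {m : E}
    (hm : m = (n : ℝ)⁻¹ • ∑ i, z i) (w : E) :
    (n : ℝ)⁻¹ * ∑ i, ‖z i - w‖ ^ 2 = ‖m - w‖ ^ 2 + (n : ℝ)⁻¹ * ∑ i, ‖z i - m‖ ^ 2 := by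
  have hn' : (n : ℝ) ≠ 0 := Nat.cast_ne_zero.2 hn
  have hzero : ∑ i, (z i - m) = 0 := by
    rw [Finset.sum_sub_distrib, hm]
    simp [← Nat.cast_smul_eq_nsmul ℝ, smul_smul, hn']
  have hexp (i : Fin n) : ‖z i - w‖ ^ 2
      = ‖z i - m‖ ^ 2 + 2 * ⟪z i - m, m - w⟫ + ‖m - w‖ ^ 2 := by
    rw [← norm_add_sq_real, sub_add_sub_cancel]
  simp only [hexp, Finset.sum_add_distrib, ← Finset.mul_sum, ← sum_inner, hzero, inner_zero_left]
  simp only [Finset.sum_const, Finset.card_univ, Fintype.card_fin, nsmul_eq_mul]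
  field_simp
  ring

lemma norm_mean_sub_sq_le {n : ℕ} (hn : n ≠ 0) (z : Fin n → E) {m : E}
    (hm : m = (n : ℝ)⁻¹ • ∑ i, z i) (w : E) :
    ‖m - w‖ ^ 2 ≤ (n : ℝ)⁻¹ * ∑ i, ‖z i - w‖ ^ 2 := by
  rw [sum_norm_sub_sq_eq hn z hm w]
  have : 0 ≤ (n : ℝ)⁻¹ * ∑ i, ‖z i - m‖ ^ 2 := by positivity
  linarith

variable [CompleteSpace E]

lemma inner_hessian_symm {φ : E → ℝ} {g : E → E} {A : E →L[ℝ] E} {y : E}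
    (hφ : ∀ x, HasGradientAt φ (g x) x) (hg : HasFDerivAt g A y) (u v : E) :
    ⟪A u, v⟫ = ⟪u, A v⟫ := by
  have h := second_derivative_symmetric (𝕜 := ℝ) (fun x => (hφ x).hasFDerivAt)
    ((InnerProductSpace.toDual ℝ E).toContinuousLinearEquiv.toContinuousLinearMap.hasFDerivAt.comp
      y hg) u v
  rw [real_inner_comm (A v) u]
  simpa using h

lemma mul_norm_sq_le_inner_hessian {φ : E → ℝ} {g : E → E} {A : E →L[ℝ] E} {y : E} {σ : ℝ}
    (hφ : ∀ x, HasGradientAt φ (g x) x) (hg : HasFDerivAt g A y)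
    (hconv : ConvexOn ℝ Set.univ fun x => φ x - σ / 2 * ‖x‖ ^ 2) (u : E) :
    σ * ‖u‖ ^ 2 ≤ ⟪A u, u⟫ := by
  have hline (t : ℝ) : HasDerivAt (fun t : ℝ => y + t • u) u t := by
    simpa using ((hasDerivAt_id t).smul_const u).const_add y
  have hderiv (t : ℝ) : HasDerivAt (fun t : ℝ => φ (y + t • u) - σ / 2 * ‖y + t • u‖ ^ 2)
      (⟪g (y + t • u), u⟫ - σ * ⟪y + t • u, u⟫) t := by
    have h1 := (hφ (y + t • u)).hasFDerivAt.comp_hasDerivAt t (hline t)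
    have h2 := ((hline t).norm_sq).const_mul (σ / 2)
    refine (h1.sub h2).congr_deriv ?_
    simp
    ring
  have hconv' : ConvexOn ℝ Set.univ (fun t : ℝ => φ (y + t • u) - σ / 2 * ‖y + t • u‖ ^ 2) := by
    have h := hconv.comp_affineMap (AffineMap.lineMap (k := ℝ) y (y + u))
    refine (h.congr fun t _ => ?_)
    simp [AffineMap.lineMap_apply, add_comm]
  have hmono : Monotone fun t : ℝ => ⟪g (y + t • u), u⟫ - σ * ⟪y + t • u, u⟫ := by
    have h := hconv'.monotoneOn_deriv fun t _ => (hderiv t).differentiableAt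
    rw [monotoneOn_univ] at h
    rwa [show deriv _ = _ from funext fun t => (hderiv t).deriv] at h
  have hsecond : HasDerivAt (fun t : ℝ => ⟪g (y + t • u), u⟫ - σ * ⟪y + t • u, u⟫)
      (⟪A u, u⟫ - σ * ⟪u, u⟫) 0 := by
    have hg0 : HasFDerivAt g A (y + (0 : ℝ) • u) := by simpa using hg
    have h1 := (hg0.comp_hasDerivAt (0 : ℝ) (hline 0)).inner ℝ (hasDerivAt_const (0 : ℝ) u)
    have h2 := ((hline 0).inner ℝ (hasDerivAt_const (0 : ℝ) u)).const_mul σ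
    exact (h1.sub h2).congr_deriv (by simp)
  have := hsecond.nonneg_of_monotone hmono
  rw [real_inner_self_eq_norm_sq] at this
  linarith

lemma HasGradientAt.mean {n : ℕ} {φ : Fin n → E → ℝ} {g : Fin n → E} {x : E}
    (h : ∀ i, HasGradientAt (φ i) (g i) x) :
    HasGradientAt (fun x => (n : ℝ)⁻¹ * ∑ i, φ i x) ((n : ℝ)⁻¹ • ∑ i, g i) x := by
  rw [hasGradientAt_iff_hasFDerivAt]
  refine ((HasFDerivAt.fun_sum fun i _ => (h i).hasFDerivAt).const_mul (n : ℝ)⁻¹).congr_fderiv ?_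
  simp

end InnerProduct

section Mixing

/-- A symmetric stochastic matrix with eigenvalues `lam`, all but the first in `[-ρ, ρ]` and
different from `1`, contracts mean-zero vectors by `ρ`. -/
lemma sum_mulVec_sq_le {ι : Type*} [Fintype ι] [DecidableEq ι] {W P : Matrix ι ι ℝ} {lam : ι → ℝ}
    {ρ : ℝ} (k₀ : ι) (hW_rows : ∀ i, ∑ j, W i j = 1) (hP : P * Pᵀ = 1)
    (hdiag : W = P * diagonal lam * Pᵀ) (hlam : ∀ k ≠ k₀, lam k ≠ 1 ∧ |lam k| ≤ ρ)
    {a : ι → ℝ} (ha : ∑ i, a i = 0) :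
    ∑ i, (W *ᵥ a) i ^ 2 ≤ ρ ^ 2 * ∑ i, a i ^ 2 := by
  have hP' : Pᵀ * P = 1 := mul_eq_one_comm.1 hP
  have hsq (Q : Matrix ι ι ℝ) (hQ : Qᵀ * Q = 1) (b : ι → ℝ) :
      ∑ i, (Q *ᵥ b) i ^ 2 = ∑ i, b i ^ 2 := by
    have : Q *ᵥ b ⬝ᵥ Q *ᵥ b = b ⬝ᵥ b := by
      rw [dotProduct_mulVec, ← mulVec_transpose, mulVec_mulVec, hQ, one_mulVec]
    simpa [dotProduct, sq] using this
  have hPW : Pᵀ * W = diagonal lam * Pᵀ := by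
    rw [hdiag, ← Matrix.mul_assoc, ← Matrix.mul_assoc, hP', Matrix.one_mul]
  set c := Pᵀ *ᵥ (1 : ι → ℝ) with hc
  set b := Pᵀ *ᵥ a with hb
  have hone : W *ᵥ (1 : ι → ℝ) = 1 := by
    ext i
    simpa [mulVec, dotProduct] using hW_rows i
  have hck (k : ι) (hk : k ≠ k₀) : c k = 0 := by
    have h : c = diagonal lam *ᵥ c := by
      rw [hc, mulVec_mulVec, ← hPW, ← mulVec_mulVec, hone]
    have h' := congrFun h k
    rw [mulVec_diagonal] at h'
    have : (lam k - 1) * c k = 0 := by linarith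
    exact (mul_eq_zero.1 this).resolve_left (sub_ne_zero.2 (hlam k hk).1)
  have hbk₀ : b k₀ = 0 := by
    have hcb : c k₀ * b k₀ = 0 := by
      have h : c ⬝ᵥ b = 0 := by
        rw [hc, hb, dotProduct_mulVec, ← mulVec_transpose, transpose_transpose, mulVec_mulVec, hP,
          one_mulVec]
        simpa [dotProduct] using ha
      rwa [dotProduct, Finset.sum_eq_single k₀ (fun k _ hk => by rw [hck k hk, zero_mul])
        (by simp)] at h
    refine (mul_eq_zero.1 hcb).resolve_left fun h0 => ?_
    have hc0 : c = 0 := funext fun k => by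
      by_cases hk : k = k₀
      · rw [hk, h0]; rfl
      · exact hck k hk
    have : (1 : ι → ℝ) = 0 := by
      rw [← one_mulVec (1 : ι → ℝ), ← hP, ← mulVec_mulVec, ← hc, hc0, mulVec_zero]
    simpa using congrFun this k₀
  have hWa : W *ᵥ a = P *ᵥ (diagonal lam *ᵥ b) := by
    rw [hdiag, hb, mulVec_mulVec, mulVec_mulVec]
  rw [hWa, hsq P hP', ← hsq Pᵀ (by rwa [transpose_transpose]) a, ← hb, Finset.mul_sum]
  refine Finset.sum_le_sum fun k _ => ?_
  rw [mulVec_diagonal]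
  by_cases hk : k = k₀
  · simp [hk, hbk₀]
  · rw [mul_pow]
    gcongr ?_ * _
    rw [← sq_abs (lam k)]
    gcongr
    exact (hlam k hk).2

lemma sum_norm_mixing_sq_le {ι : Type*} [Fintype ι] [DecidableEq ι] {d : ℕ} {W P : Matrix ι ι ℝ}
    {lam : ι → ℝ} {ρ : ℝ} (k₀ : ι) (hW_rows : ∀ i, ∑ j, W i j = 1) (hP : P * Pᵀ = 1)
    (hdiag : W = P * diagonal lam * Pᵀ) (hlam : ∀ k ≠ k₀, lam k ≠ 1 ∧ |lam k| ≤ ρ)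
    {a : ι → Vec d} (ha : ∑ i, a i = 0) :
    ∑ i, ‖∑ j, W i j • a j‖ ^ 2 ≤ ρ ^ 2 * ∑ i, ‖a i‖ ^ 2 := by
  simp only [EuclideanSpace.real_norm_sq_eq]
  rw [Finset.sum_comm, Finset.sum_comm (f := fun i c => (a i).ofLp c ^ 2), Finset.mul_sum]
  refine Finset.sum_le_sum fun c _ => ?_
  have hac : ∑ i, a i c = 0 := by simpa using congrArg (fun v : Vec d => v c) ha
  have h := sum_mulVec_sq_le k₀ hW_rows hP hdiag hlam hac
  simpa [mulVec, dotProduct] using h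

/-- Deviation from the mean after mixing `v + η t`, for a matrix as in `sum_mulVec_sq_le`. -/
lemma mean_norm_mixed_step_sub_sq_le {n d : ℕ} (hn : n ≠ 0) {W P : Matrix (Fin n) (Fin n) ℝ}
    {lam : Fin n → ℝ} {ρ η : ℝ} (hη0 : 0 < η) (k₀ : Fin n) (hW_rows : ∀ i, ∑ j, W i j = 1)
    (hP : P * Pᵀ = 1) (hdiag : W = P * diagonal lam * Pᵀ)
    (hlam : ∀ k ≠ k₀, lam k ≠ 1 ∧ |lam k| ≤ ρ) (V tv : Fin n → Vec d) {vbar tvbar : Vec d}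
    (hvbar : vbar = (n : ℝ)⁻¹ • ∑ i, V i) (htvbar : tvbar = (n : ℝ)⁻¹ • ∑ i, tv i) :
    (n : ℝ)⁻¹ * ∑ i, ‖∑ j, W i j • (V j + η • tv j) - (vbar + η • tvbar)‖ ^ 2
      ≤ 2 * ρ ^ 2 * ((n : ℝ)⁻¹ * ∑ i, ‖V i - vbar‖ ^ 2)
        + 2 * η ^ 2 * ρ ^ 2 / n * ∑ i, ‖tv i - tvbar‖ ^ 2 := by
  have hnR : (n : ℝ) ≠ 0 := Nat.cast_ne_zero.2 hn
  set zbar : Vec d := vbar + η • tvbar with hzbar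
  have hdev (i : Fin n) : ∑ j, W i j • (V j + η • tv j) - zbar
      = ∑ j, W i j • (V j + η • tv j - zbar) := by
    simp only [smul_sub, Finset.sum_sub_distrib, ← Finset.sum_smul, hW_rows, one_smul]
  have hzero : ∑ j, (V j + η • tv j - zbar) = 0 := by
    rw [Finset.sum_sub_distrib, Finset.sum_add_distrib, ← Finset.smul_sum, hzbar, hvbar, htvbar]
    simp only [Finset.sum_const, Finset.card_univ, Fintype.card_fin, ← Nat.cast_smul_eq_nsmul ℝ,
      smul_add, smul_comm η, smul_inv_smul₀ hnR, sub_self]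
  have hcontr := sum_norm_mixing_sq_le _ hW_rows hP hdiag hlam hzero
  simp only [← hdev] at hcontr
  have hterm (j : Fin n) : ‖V j + η • tv j - zbar‖ ^ 2
      ≤ 2 * ‖V j - vbar‖ ^ 2 + 2 * η ^ 2 * ‖tv j - tvbar‖ ^ 2 := by
    have h : V j + η • tv j - zbar = (V j - vbar) + η • (tv j - tvbar) := by
      rw [hzbar, smul_sub]; abel
    have h' := norm_add_le (V j - vbar) (η • (tv j - tvbar))
    rw [norm_smul, Real.norm_of_nonneg hη0.le] at h'
    rw [h]
    calc _ ≤ (‖V j - vbar‖ + η * ‖tv j - tvbar‖) ^ 2 := by gcongr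
      _ ≤ _ := by linear_combination add_sq_le (a := ‖V j - vbar‖) (b := η * ‖tv j - tvbar‖)
  have hsum := Finset.sum_le_sum fun j (_ : j ∈ Finset.univ) => hterm j
  rw [Finset.sum_add_distrib, ← Finset.mul_sum, ← Finset.mul_sum] at hsum
  calc _ ≤ (n : ℝ)⁻¹ * (ρ ^ 2 * (2 * ∑ i, ‖V i - vbar‖ ^ 2
        + 2 * η ^ 2 * ∑ i, ‖tv i - tvbar‖ ^ 2)) := by
        gcongr
        exact hcontr.trans (by gcongr)
    _ = _ := by ring

end Mixing

/-- `a` is the new squared error, `z` that of the averaged step before projection, `m` the variance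
after mixing, `u` the old squared error, `b` the squared error of the averaged direction. -/
lemma combine_contraction_estimates {n σ η M l u y S D a z m b r T : ℝ} (hn : 0 < n) (hσ : 0 < σ)
    (hη : 0 < η) (hM : 0 ≤ M) (hl : 0 ≤ l) (hu : 0 ≤ u) (hy : 0 ≤ y) (hS : 0 ≤ S) (hD : 0 ≤ D)
    (ha : a ≤ z + m) (hm : m ≤ 2 * r * D + 2 * η ^ 2 * r / n * T)
    (hz : z ≤ (1 - η * σ) * u + η / σ * b) (hb : b ≤ 2 * M * (y + n⁻¹ * S) + 2 * l * D) :
    a ≤ (1 - η * σ / 2) * u + 3 * η * M / σ * y + 9 * η * M / (n * σ) * S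
      + 2 * η ^ 2 * r / n * T + (9 * η * l / σ + 2 * r) * D := by
  have hηb := mul_le_mul_of_nonneg_left hb (div_pos hη hσ).le
  have hA : 0 ≤ η * σ / 2 * u := by positivity
  have hB : 0 ≤ η / σ * M * y := by positivity
  have hC : 0 ≤ 7 * (η / σ) * M * (n⁻¹ * S) := by positivity
  have hE : 0 ≤ 7 * (η / σ) * l * D := by positivity
  have hcoef : 9 * η * M / (n * σ) * S = 9 * (η / σ) * M * (n⁻¹ * S) := by
    field_simp
  rw [hcoef]
  linear_combination ha + hm + hz + hηb + hA + hB + hC + hE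

/-- One-step contraction for the average `v`-iterate of SLDBO
(projected update with gradient tracking), cf. Lemma on `‖v̄⁺ − v*‖²`. -/
theorem vbar_contraction {n p q : ℕ} (hn : 2 ≤ n)
    (σ LF0 LF1 Lf1 Lf2 rv ρ η : ℝ)
    (hσ : 0 < σ) (hLF0 : 0 ≤ LF0) (hLF1 : 0 ≤ LF1) (hLf1 : 0 ≤ Lf1) (hLf2 : 0 ≤ Lf2)
    (hrv : rv = LF0 / σ)
    (hη0 : 0 < η) (hη : η ≤ 1 / Lf1) (hησ : η * σ ≤ 1)
    -- the mixing matrix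
    (W : Matrix (Fin n) (Fin n) ℝ)
    (hW_nonneg : ∀ i j, 0 ≤ W i j)
    (hW_symm : W.IsSymm)
    (hW_rows : ∀ i, ∑ j, W i j = 1)
    (hW_cols : ∀ j, ∑ i, W i j = 1)
    (lam : Fin n → ℝ) (P : Matrix (Fin n) (Fin n) ℝ)
    (hP : P * Pᵀ = 1)
    (hdiag : W = P * Matrix.diagonal lam * Pᵀ)
    (hlam0 : lam ⟨0, by omega⟩ = 1)
    (hgap : lam ⟨1, by omega⟩ < 1)
    (hmono : Antitone lam)
    (hρdef : ρ = max |lam ⟨1, by omega⟩| |lam ⟨n - 1, by omega⟩|)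
    (hρlt : ρ < 1)
    -- the Euclidean projection onto the closed ball of radius `r_v` centered at the origin
    (proj : Vec q → Vec q)
    (hproj_mem : ∀ z, proj z ∈ Metric.closedBall (0 : Vec q) rv)
    (hproj_min : ∀ z, ∀ w ∈ Metric.closedBall (0 : Vec q) rv, ‖proj z - z‖ ≤ ‖w - z‖)
    -- the objective data
    (F f : Fin n → Vec p → Vec q → ℝ)
    (gF1 : Fin n → Vec p → Vec q → Vec p) (gF2 : Fin n → Vec p → Vec q → Vec q)
    (g1 : Fin n → Vec p → Vec q → Vec p) (g2 : Fin n → Vec p → Vec q → Vec q)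
    (f22 : Fin n → Vec p → Vec q → (Vec q →L[ℝ] Vec q))
    (hgF1 : ∀ i x y, HasGradientAt (fun x' => F i x' y) (gF1 i x y) x)
    (hgF2 : ∀ i x y, HasGradientAt (fun y' => F i x y') (gF2 i x y) y)
    (hg1 : ∀ i x y, HasGradientAt (fun x' => f i x' y) (g1 i x y) x)
    (hg2 : ∀ i x y, HasGradientAt (fun y' => f i x y') (g2 i x y) y)
    (hf22 : ∀ i x y, HasFDerivAt (fun y' => g2 i x y') (f22 i x y) y)
    -- `Fᵢ` is `L_{F,0}`-Lipschitz
    (hFlip : ∀ i x y x' y',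
      |F i x y - F i x' y'| ≤ LF0 * Real.sqrt (‖x - x'‖ ^ 2 + ‖y - y'‖ ^ 2))
    -- `∇Fᵢ` is `L_{F,1}`-Lipschitz
    (hgFlip : ∀ i x y x' y',
      ‖gF1 i x y - gF1 i x' y'‖ ^ 2 + ‖gF2 i x y - gF2 i x' y'‖ ^ 2
        ≤ LF1 ^ 2 * (‖x - x'‖ ^ 2 + ‖y - y'‖ ^ 2))
    -- `∇fᵢ` is `L_{f,1}`-Lipschitz
    (hglip : ∀ i x y x' y',
      ‖g1 i x y - g1 i x' y'‖ ^ 2 + ‖g2 i x y - g2 i x' y'‖ ^ 2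
        ≤ Lf1 ^ 2 * (‖x - x'‖ ^ 2 + ‖y - y'‖ ^ 2))
    -- `∇²fᵢ` is `L_{f,2}`-Lipschitz
    (hf22lip : ∀ i x y x' y',
      ‖f22 i x y - f22 i x' y'‖ ≤ Lf2 * Real.sqrt (‖x - x'‖ ^ 2 + ‖y - y'‖ ^ 2))
    -- the iterates and their averages
    (X : Fin n → Vec p) (Y V tv : Fin n → Vec q)
    (xbar : Vec p) (hxbar : xbar = (n : ℝ)⁻¹ • ∑ i, X i)
    (ybar : Vec q) (hybar : ybar = (n : ℝ)⁻¹ • ∑ i, Y i)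
    (vbar : Vec q) (hvbar : vbar = (n : ℝ)⁻¹ • ∑ i, V i)
    (hV : ∀ i, ‖V i‖ ≤ rv)
    -- `f(x̄, ·)` is `σ`-strongly convex, where `f = (1/n) ∑ fᵢ`
    (hsc : ConvexOn ℝ Set.univ
      (fun y : Vec q => (n : ℝ)⁻¹ * ∑ i, f i xbar y - σ / 2 * ‖y‖ ^ 2))
    -- `y*` and `v*`: `∇₂f(x̄, y*) = 0`, `∇²₂₂f(x̄, y*) v* = ∇₂F(x̄, y*)`, `‖v*‖ ≤ r_v`
    (ystar vstar : Vec q)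
    (hystar : (n : ℝ)⁻¹ • ∑ i, g2 i xbar ystar = 0)
    (hvstar : (n : ℝ)⁻¹ • ∑ i, (f22 i xbar ystar) vstar
      = (n : ℝ)⁻¹ • ∑ i, gF2 i xbar ystar)
    (hvstar_norm : ‖vstar‖ ≤ rv)
    -- the tracking variables average to the average direction `d̄_v`
    (tvbar : Vec q) (htvbar : tvbar = (n : ℝ)⁻¹ • ∑ i, tv i)
    (htrack : tvbar = (n : ℝ)⁻¹ • ∑ i, (gF2 i (X i) (Y i) - (f22 i (X i) (Y i)) (V i)))
    -- the projected update
    (Vplus : Fin n → Vec q)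
    (hVplus : ∀ i, Vplus i = proj (∑ j, W i j • (V j + η • tv j)))
    (vbarplus : Vec q) (hvbarplus : vbarplus = (n : ℝ)⁻¹ • ∑ i, Vplus i) :
    ‖vbarplus - vstar‖ ^ 2
      ≤ (1 - η * σ / 2) * ‖vbar - vstar‖ ^ 2
        + 3 * η * (LF1 + Lf2 * rv) ^ 2 / σ * ‖ybar - ystar‖ ^ 2
        + 9 * η * (LF1 + Lf2 * rv) ^ 2 / (n * σ)
            * ∑ i, (‖X i - xbar‖ ^ 2 + ‖Y i - ybar‖ ^ 2)
        + 2 * η ^ 2 * ρ ^ 2 / n * ∑ i, ‖tv i - tvbar‖ ^ 2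
        + (9 * η * Lf1 ^ 2 / σ + 2 * ρ ^ 2) * ((n : ℝ)⁻¹ * ∑ i, ‖V i - vbar‖ ^ 2) := by
  have hn0 : n ≠ 0 := by omega
  have hrv0 : 0 ≤ rv := hrv ▸ div_nonneg hLF0 hσ.le
  have hηL : η * Lf1 ≤ 1 := by
    rcases hLf1.eq_or_lt with h | h
    · rw [← h]; simp
    · rwa [le_div_iff₀ h] at hη
  have hlam : ∀ k ≠ (⟨0, by omega⟩ : Fin n), lam k ≠ 1 ∧ |lam k| ≤ ρ := by
    intro k hk
    have hk0 : (k : ℕ) ≠ 0 := fun h => hk (Fin.ext h)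
    have h1 : lam k ≤ lam ⟨1, by omega⟩ := hmono (Fin.mk_le_of_le_val (by omega))
    have h2 : lam ⟨n - 1, by omega⟩ ≤ lam k := hmono (Fin.le_def.2 (by simp; omega))
    refine ⟨(h1.trans_lt hgap).ne, ?_⟩
    rw [hρdef, abs_le]
    constructor
    · linarith [neg_abs_le (lam ⟨n - 1, by omega⟩), le_max_right |lam ⟨1, by omega⟩|
        |lam ⟨n - 1, by omega⟩|]
    · exact h1.trans ((le_abs_self _).trans (le_max_left _ _))
  -- the mixing step
  set z : Fin n → Vec q := fun i => ∑ j, W i j • (V j + η • tv j) with hz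
  set zbar : Vec q := vbar + η • tvbar with hzbar
  have hzmean : zbar = (n : ℝ)⁻¹ • ∑ i, z i := by
    simp only [hz]
    rw [Finset.sum_comm]
    simp only [← Finset.sum_smul, hW_cols, one_smul, Finset.sum_add_distrib, ← Finset.smul_sum,
      smul_add]
    rw [hzbar, hvbar, htvbar, smul_comm]
  have hmix : (n : ℝ)⁻¹ * ∑ i, ‖z i - zbar‖ ^ 2
      ≤ 2 * ρ ^ 2 * ((n : ℝ)⁻¹ * ∑ i, ‖V i - vbar‖ ^ 2)
        + 2 * η ^ 2 * ρ ^ 2 / n * ∑ i, ‖tv i - tvbar‖ ^ 2 :=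
    mean_norm_mixed_step_sub_sq_le hn0 hη0 _ hW_rows hP hdiag hlam V tv hvbar htvbar
  have hproj : ‖vbarplus - vstar‖ ^ 2
      ≤ ‖zbar - vstar‖ ^ 2 + (n : ℝ)⁻¹ * ∑ i, ‖z i - zbar‖ ^ 2 := by
    rw [← sum_norm_sub_sq_eq hn0 z hzmean]
    refine (norm_mean_sub_sq_le hn0 Vplus hvbarplus vstar).trans ?_
    gcongr with i
    rw [hVplus i]
    exact norm_sub_le_of_isNearest (convex_closedBall _ _) (hproj_mem _) (hproj_min _)
      (by simpa using hvstar_norm)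
  -- the averaged Hessian at the solution
  set H : Vec q →L[ℝ] Vec q := (n : ℝ)⁻¹ • ∑ i, f22 i xbar ystar with hH
  have hHapply (u : Vec q) : H u = (n : ℝ)⁻¹ • ∑ i, f22 i xbar ystar u := by
    simp [hH]
  have hgrad (y : Vec q) := HasGradientAt.mean fun i => hg2 i xbar y
  have hhess : HasFDerivAt (fun y => (n : ℝ)⁻¹ • ∑ i, g2 i xbar y) H ystar :=
    (HasFDerivAt.fun_sum fun i _ => hf22 i xbar ystar).fun_const_smul _
  have hf22norm (i : Fin n) : ‖f22 i xbar ystar‖ ≤ Lf1 := by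
    refine (hf22 i xbar ystar).le_of_lip' hLf1 (Filter.Eventually.of_forall fun y => ?_)
    refine abs_le_of_sq_le_sq' ?_ (by positivity) |>.2
    have h := hglip i xbar y xbar ystar
    rw [sub_self xbar, norm_zero] at h
    nlinarith [sq_nonneg ‖g1 i xbar y - g1 i xbar ystar‖]
  have hHnorm : ‖H‖ ≤ Lf1 := by
    have h : ‖∑ i, f22 i xbar ystar‖ ≤ n * Lf1 := by
      simpa using norm_sum_le_of_le Finset.univ fun i _ => hf22norm i
    rw [hH, norm_smul, Real.norm_of_nonneg (by positivity), inv_mul_le_iff₀ (by positivity)]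
    exact h
  -- the error of the averaged direction
  set e : Fin n → Vec q := fun i => (gF2 i (X i) (Y i) - gF2 i xbar ystar)
    - (f22 i (X i) (Y i) - f22 i xbar ystar) (V i) - f22 i xbar ystar (V i - vbar) with he
  set ebar : Vec q := (n : ℝ)⁻¹ • ∑ i, e i with hebar
  have hstep : zbar - vstar = (vbar - vstar) - η • H (vbar - vstar) + η • ebar := by
    have hsum : ebar = tvbar - H vstar + H vbar := by
      rw [hebar, hHapply vstar, hvstar, hHapply, htrack, ← smul_sub, ← smul_add,
        ← Finset.sum_sub_distrib, ← Finset.sum_add_distrib]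
      congr 1
      refine Finset.sum_congr rfl fun i _ => ?_
      simp only [he, _root_.sub_apply, map_sub]
      abel
    rw [hsum, hzbar, map_sub]
    module
  have hquad : ‖zbar - vstar‖ ^ 2
      ≤ (1 - η * σ) * ‖vbar - vstar‖ ^ 2 + η / σ * ‖ebar‖ ^ 2 := by
    rw [hstep]
    exact norm_sq_inexact_step_le H hσ hη0 hηL hησ (inner_hessian_symm hgrad hhess)
      (mul_norm_sq_le_inner_hessian hgrad hhess hsc) hHnorm _ _
  have he_le (i : Fin n) : ‖e i‖ ^ 2
      ≤ 2 * (LF1 + Lf2 * rv) ^ 2 * (‖X i - xbar‖ ^ 2 + ‖Y i - ystar‖ ^ 2)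
        + 2 * Lf1 ^ 2 * ‖V i - vbar‖ ^ 2 := by
    set s := Real.sqrt (‖X i - xbar‖ ^ 2 + ‖Y i - ystar‖ ^ 2) with hs
    have hs2 : s ^ 2 = ‖X i - xbar‖ ^ 2 + ‖Y i - ystar‖ ^ 2 := Real.sq_sqrt (by positivity)
    have h1 : ‖gF2 i (X i) (Y i) - gF2 i xbar ystar‖ ≤ LF1 * s := by
      refine abs_le_of_sq_le_sq' ?_ (by positivity) |>.2
      rw [mul_pow, hs2]
      nlinarith [hgFlip i (X i) (Y i) xbar ystar,
        sq_nonneg ‖gF1 i (X i) (Y i) - gF1 i xbar ystar‖]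
    have h2 : ‖(f22 i (X i) (Y i) - f22 i xbar ystar) (V i)‖ ≤ Lf2 * s * rv :=
      (ContinuousLinearMap.le_of_opNorm_le _ (hf22lip i _ _ _ _) _).trans
        (by gcongr; exact hV i)
    have h3 : ‖f22 i xbar ystar (V i - vbar)‖ ≤ Lf1 * ‖V i - vbar‖ :=
      ContinuousLinearMap.le_of_opNorm_le _ (hf22norm i) _
    have h4 : ‖e i‖ ≤ (LF1 + Lf2 * rv) * s + Lf1 * ‖V i - vbar‖ := by
      refine (norm_sub_le _ _).trans ((add_le_add_left (norm_sub_le _ _) _).trans ?_)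
      linarith
    rw [← hs2]
    calc ‖e i‖ ^ 2 ≤ ((LF1 + Lf2 * rv) * s + Lf1 * ‖V i - vbar‖) ^ 2 := by gcongr
      _ ≤ _ := by linear_combination add_sq_le (a := (LF1 + Lf2 * rv) * s) (b := Lf1 * ‖V i - vbar‖)
  have hebar_le : ‖ebar‖ ^ 2 ≤ 2 * (LF1 + Lf2 * rv) ^ 2 * (‖ybar - ystar‖ ^ 2
        + (n : ℝ)⁻¹ * ∑ i, (‖X i - xbar‖ ^ 2 + ‖Y i - ybar‖ ^ 2))
      + 2 * Lf1 ^ 2 * ((n : ℝ)⁻¹ * ∑ i, ‖V i - vbar‖ ^ 2) := by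
    have h := norm_mean_sub_sq_le hn0 e hebar 0
    simp only [sub_zero] at h
    have hsum := Finset.sum_le_sum fun i (_ : i ∈ Finset.univ) => he_le i
    rw [Finset.sum_add_distrib, ← Finset.mul_sum, ← Finset.mul_sum, Finset.sum_add_distrib] at hsum
    have hvar := sum_norm_sub_sq_eq hn0 Y hybar ystar
    have hsum' := mul_le_mul_of_nonneg_left hsum (inv_nonneg.2 (Nat.cast_nonneg (α := ℝ) n))
    rw [Finset.sum_add_distrib]
    linear_combination h + hsum' + 2 * (LF1 + Lf2 * rv) ^ 2 * hvar
  exact combine_contraction_estimates (Nat.cast_pos.2 (Nat.pos_of_ne_zero hn0)) hσ hη0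
    (sq_nonneg _) (sq_nonneg _) (sq_nonneg _) (sq_nonneg _)
    (Finset.sum_nonneg fun i _ => add_nonneg (sq_nonneg _) (sq_nonneg _))
    (mul_nonneg (inv_nonneg.2 (Nat.cast_nonneg n)) (Finset.sum_nonneg fun i _ => sq_nonneg _))
    hproj hmix hquad hebar_le
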